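/- arXiv:2311.07189 — 5 statements merged into one kernel-verified Lean document; each statement's English description precedes it below -/
import Mathlib

section
/- Let L be a first-order language, let σ be a ∀∃-Special Horn L-sentence, and let f : A → B be a ∀-embedding of L-structures. If B ⊨ σ, then A ⊨ σ. -/
open FirstOrder FirstOrder.Language

universe u v w

namespace Pi2Rules

variable {L : FirstOrder.Language.{u, v}}

/-- Universal quantification of the last `k` bound variables of a bounded formula. -/
def allsOn {α : Type*} : ∀ (k : ℕ) {n : ℕ}, L.BoundedFormula α (n + k) → L.BoundedFormula α n
  | 0, _, φ => φ
  | k + 1, _, φ => allsOn k φ.all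

/-- Finite conjunction of bounded formulas. -/
def conj {α : Type*} {n : ℕ} : ∀ {j : ℕ}, (Fin j → L.BoundedFormula α n) → L.BoundedFormula α n
  | 0, _ => ⊤
  | _ + 1, φs => φs 0 ⊓ conj (fun i => φs i.succ)

/-- The sentence `∀ x̄ (∀ ȳ (λ₁(x̄,ȳ) ∧ ⋯ ∧ λⱼ(x̄,ȳ)) → γ(x̄))`. -/
def specialHorn {m k j : ℕ} (lam : Fin j → L.BoundedFormula Empty (m + k))
    (γ : L.BoundedFormula Empty m) : L.Sentence :=
  ((allsOn k (conj lam)).imp γ).alls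

/-- A `∀∃`-Special Horn sentence: one of the form
`∀ x̄ (∀ ȳ (λ₁(x̄,ȳ) ∧ ⋯ ∧ λⱼ(x̄,ȳ)) → γ(x̄))` with the `λᵢ` and `γ` atomic. -/
def IsSpecialHorn (σ : L.Sentence) : Prop :=
  ∃ (m k j : ℕ) (lam : Fin j → L.BoundedFormula Empty (m + k))
    (γ : L.BoundedFormula Empty m),
      (∀ i, (lam i).IsAtomic) ∧ γ.IsAtomic ∧ σ = specialHorn lam γ

/-- An embedding `f : A ↪[L] B` is a `∀`-embedding if for every atomic formula `φ(x̄,ȳ)` and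
every tuple `ā` from `A`, if `A ⊨ ∀ x̄ φ(x̄,ā)` then `B ⊨ ∀ x̄ φ(x̄,f(ā))`. -/
def IsForallEmbedding {A B : Type*} [L.Structure A] [L.Structure B] (f : A ↪[L] B) : Prop :=
  ∀ (n m : ℕ) (φ : L.BoundedFormula (Fin m) n), φ.IsAtomic →
    ∀ a : Fin m → A, (∀ x : Fin n → A, φ.Realize a x) → ∀ y : Fin n → B, φ.Realize (f ∘ a) y

/-- The pointwise structure on a direct product of `L`-structures. -/
instance piStructure {ι : Type*} (M : ι → Type*) [∀ i, L.Structure (M i)] :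
    L.Structure (∀ i, M i) where
  funMap f x i := Structure.funMap f fun j => x j i
  RelMap r x := ∀ i, Structure.RelMap r fun j => x j i

end Pi2Rules

open Pi2Rules

namespace Pi2Rules

section

variable {L : FirstOrder.Language.{u, v}} {M : Type*} [L.Structure M]

theorem realize_allsOn {α : Type*} (k : ℕ) {n : ℕ} (φ : L.BoundedFormula α (n + k))
    (v : α → M) (xs : Fin n → M) :
    (allsOn k φ).Realize v xs ↔ ∀ ys : Fin k → M, φ.Realize v (Fin.append xs ys) := by
  induction k with
  | zero => simp [allsOn, Fin.append_right_nil]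
  | succ k ih =>
    rw [allsOn, ih φ.all]
    simp only [BoundedFormula.realize_all]
    refine ⟨fun h ys => ?_, fun h ys y => ?_⟩
    · rw [← Fin.snoc_init_self ys, Fin.append_snoc]
      exact h (Fin.init ys) (ys (Fin.last k))
    · have := h (Fin.snoc ys y)
      rwa [Fin.append_snoc] at this

theorem realize_conj {α : Type*} {n j : ℕ} (φs : Fin j → L.BoundedFormula α n)
    (v : α → M) (xs : Fin n → M) :
    (conj φs).Realize v xs ↔ ∀ i, (φs i).Realize v xs := by
  induction j with
  | zero => simp [conj]
  | succ j ih => simp [conj, ih, Fin.forall_fin_succ]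

theorem realize_specialHorn {m k j : ℕ} (lam : Fin j → L.BoundedFormula Empty (m + k))
    (γ : L.BoundedFormula Empty m) :
    M ⊨ specialHorn lam γ ↔ ∀ xs : Fin m → M,
      (∀ (ys : Fin k → M) (i : Fin j), (lam i).Realize default (Fin.append xs ys)) →
        γ.Realize default xs := by
  simp only [Sentence.Realize, specialHorn, BoundedFormula.realize_alls,
    BoundedFormula.realize_imp, realize_allsOn, realize_conj]

/-- Turn the first `m` bound variables of a term into free variables. -/
def freeInitial {m k : ℕ} (t : L.Term (Empty ⊕ Fin (m + k))) : L.Term (Fin m ⊕ Fin k) :=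
  t.relabel (Sum.elim Empty.elim finSumFinEquiv.symm)

theorem realize_freeInitial {m k : ℕ} (t : L.Term (Empty ⊕ Fin (m + k)))
    (v : Empty → M) (xs : Fin m → M) (ys : Fin k → M) :
    (freeInitial t).realize (Sum.elim xs ys) = t.realize (Sum.elim v (Fin.append xs ys)) := by
  rw [freeInitial, Term.realize_relabel]
  congr 1
  ext i
  rcases i with i | i
  · exact i.elim
  · induction i using Fin.addCases <;> simp

theorem IsForallEmbedding.realize_append {A B : Type*} [L.Structure A] [L.Structure B]
    {f : A ↪[L] B} (hf : IsForallEmbedding f) {m k : ℕ} {φ : L.BoundedFormula Empty (m + k)}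
    (hφ : φ.IsAtomic) {v : Empty → A} {w : Empty → B} {xs : Fin m → A}
    (h : ∀ ys : Fin k → A, φ.Realize v (Fin.append xs ys)) (ys : Fin k → B) :
    φ.Realize w (Fin.append (f ∘ xs) ys) := by
  cases hφ with
  | equal t₁ t₂ =>
    have := hf k m ((freeInitial t₁).bdEqual (freeInitial t₂)) (.equal _ _) xs
      (fun ys => by
        simpa only [BoundedFormula.realize_bdEqual, realize_freeInitial _ v] using h ys) ys
    simpa only [BoundedFormula.realize_bdEqual, realize_freeInitial _ w] using this
  | rel R ts =>
    have := hf k m (R.boundedFormula fun i => freeInitial (ts i)) (.rel _ _) xs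
      (fun ys => by
        simpa only [BoundedFormula.realize_rel, realize_freeInitial _ v] using h ys) ys
    simpa only [BoundedFormula.realize_rel, realize_freeInitial _ w] using this

end

end Pi2Rules

/-- ∀∃-Special Horn sentences are preserved by `∀`-embeddings, downwards. -/
theorem specialHorn_preserved_by_forallEmbedding {L : FirstOrder.Language.{u, v}}
    {A : Type*} {B : Type*} [L.Structure A] [L.Structure B]
    (σ : L.Sentence) (hσ : IsSpecialHorn σ)
    (f : A ↪[L] B) (hf : IsForallEmbedding f) (hB : B ⊨ σ) : A ⊨ σ := by
  obtain ⟨m, k, j, lam, γ, hlam, hγ, rfl⟩ := hσ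
  rw [realize_specialHorn] at hB ⊢
  intro xs h
  have hγB := hB (f ∘ xs) fun ys i => hf.realize_append (hlam i) (fun ys => h ys i) ys
  rw [Subsingleton.elim (default : Empty → B) (f ∘ default)] at hγB
  exact (hγ.isQF.realize_embedding f).1 hγB
end

section
/- Let L be a first-order language, T a set of ∀∃-Special Horn L-sentences, and T* an L-theory that is a model companion of T, meaning: (a) every model of T embeds into a model of T*, (b) every model of T* embeds into a model of T, and (c) T* is model complete, i.e., every L-embedding between models of T* is elementary. Let σ be a ∀∃-Special Horn L-sentence. Then every model of T embeds into a model of T ∪ {σ} if and only if σ holds in every model of T*. -/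
open FirstOrder FirstOrder.Language

universe u v w

namespace Pi2Rules

/-- A bundled `L`-structure. -/
structure LStruct (L : FirstOrder.Language.{u, v}) : Type (max u v (w + 1)) where
  carrier : Type w
  [str : L.Structure carrier]

attribute [instance] LStruct.str

variable {L : FirstOrder.Language.{u, v}}

/-- The direct product of a family of bundled structures, with the pointwise structure. -/
def prodStruct {ι : Type w} (M : ι → LStruct.{u, v, w} L) : LStruct.{u, v, w} L :=
  ⟨∀ i, (M i).carrier⟩

/-- The ultraproduct of a family of bundled structures. -/
def ultraStruct {ι : Type w} (u : Ultrafilter ι) (M : ι → LStruct.{u, v, w} L) :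
    LStruct.{u, v, w} L :=
  ⟨(u : Filter ι).Product fun i => (M i).carrier⟩

/-- Closure of a class of structures under isomorphism. -/
def ClosedUnderIso (K : Set (LStruct.{u, v, w} L)) : Prop :=
  ∀ A B : LStruct.{u, v, w} L, A ∈ K → Nonempty (A.carrier ≃[L] B.carrier) → B ∈ K

/-- Closure of a class of structures under `∀`-substructures: whenever `B ∈ K` and `A`
`∀`-embeds into `B` (i.e. `A` is isomorphic to a `∀`-substructure of `B`), also `A ∈ K`. -/
def ClosedUnderForallSub (K : Set (LStruct.{u, v, w} L)) : Prop :=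
  ∀ A B : LStruct.{u, v, w} L, B ∈ K →
    (∃ f : A.carrier ↪[L] B.carrier, IsForallEmbedding f) → A ∈ K

/-- Closure of a class of structures under direct products. -/
def ClosedUnderProd (K : Set (LStruct.{u, v, w} L)) : Prop :=
  ∀ (ι : Type w) (M : ι → LStruct.{u, v, w} L), (∀ i, M i ∈ K) → prodStruct M ∈ K

/-- Closure of a class of structures under ultraproducts. -/
def ClosedUnderUltra (K : Set (LStruct.{u, v, w} L)) : Prop :=
  ∀ (ι : Type w) (u : Ultrafilter ι) (M : ι → LStruct.{u, v, w} L),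
    (∀ i, M i ∈ K) → ultraStruct u M ∈ K

/-- An inductive rule class: a class of `L`-structures closed under isomorphism,
`∀`-substructures, direct products and ultraproducts. -/
def IsInductiveRuleClass (K : Set (LStruct.{u, v, w} L)) : Prop :=
  ClosedUnderIso K ∧ ClosedUnderForallSub K ∧ ClosedUnderProd K ∧ ClosedUnderUltra K

/-- The class `𝕀𝕊_∀ℙℙ_U(K)` of structures isomorphic to a `∀`-substructure of a direct
product of ultraproducts of members of `K` (equivalently: those that `∀`-embed into such a
product). -/
def ISPPu (K : Set (LStruct.{u, v, w} L)) : Set (LStruct.{u, v, w} L) :=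
  {A | ∃ (ι : Type w) (J : ι → Type w) (u : ∀ i, Ultrafilter (J i))
      (M : ∀ i, J i → LStruct.{u, v, w} L), (∀ i j, M i j ∈ K) ∧
      ∃ f : A.carrier ↪[L] (prodStruct fun i => ultraStruct (u i) (M i)).carrier,
        IsForallEmbedding f}

end Pi2Rules

open Pi2Rules

namespace Pi2Rules

variable {L : FirstOrder.Language.{u, v}}

lemma isQF_conj {α : Type*} {n j : ℕ} {φs : Fin j → L.BoundedFormula α n}
    (h : ∀ i, (φs i).IsQF) : (conj φs).IsQF := by
  induction j with
  | zero => exact BoundedFormula.IsQF.top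
  | succ j ih => exact (h 0).inf (ih fun i => h i.succ)

lemma isUniversal_allsOn {α : Type*} (k : ℕ) {n : ℕ} {φ : L.BoundedFormula α (n + k)}
    (h : φ.IsUniversal) : (allsOn k φ).IsUniversal := by
  induction k with
  | zero => exact h
  | succ k ih => exact ih h.all

/-- A special Horn sentence says that a universal formula implies a quantifier-free one. -/
lemma IsSpecialHorn.exists_isUniversal_imp_isQF {σ : L.Sentence} (h : IsSpecialHorn σ) :
    ∃ (m : ℕ) (φ γ : L.BoundedFormula Empty m), φ.IsUniversal ∧ γ.IsQF ∧
      ∀ (M : Type w) [L.Structure M],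
        M ⊨ σ ↔ ∀ x : Fin m → M, φ.Realize default x → γ.Realize default x := by
  obtain ⟨m, k, j, lam, γ, hlam, hγ, rfl⟩ := h
  refine ⟨m, _, γ, isUniversal_allsOn k (isQF_conj fun i => (hlam i).isQF).isUniversal,
    hγ.isQF, fun M _ => ?_⟩
  simp only [Sentence.Realize, specialHorn, BoundedFormula.realize_alls,
    BoundedFormula.realize_imp]

/-- A special Horn sentence holds in `M` as soon as every finite tuple of `M` lies in an embedded
structure in which the sentence holds. -/
lemma IsSpecialHorn.realize_of_forall_exists_embedding {σ : L.Sentence} (h : IsSpecialHorn σ)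
    {M : Type w} [L.Structure M]
    (H : ∀ (m : ℕ) (x : Fin m → M), ∃ (B : LStruct.{u, v, w} L) (g : B.carrier ↪[L] M)
      (y : Fin m → B.carrier), B.carrier ⊨ σ ∧ g ∘ y = x) : M ⊨ σ := by
  obtain ⟨m, φ, γ, hφ, hγ, hσ⟩ := h.exists_isUniversal_imp_isQF
  rw [hσ]
  intro x hx
  obtain ⟨B, g, y, hB, rfl⟩ := H m x
  rw [← Subsingleton.elim (g ∘ default) default] at hx ⊢
  exact (hγ.realize_embedding g).2 ((hσ _).1 hB y (hφ.realize_embedding g hx))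

/-- A special Horn sentence descends along embeddings `A ↪ C ↪ D` whose composite is elementary,
from `C` to `A`. -/
lemma IsSpecialHorn.realize_of_elementary_comp {σ : L.Sentence} (h : IsSpecialHorn σ)
    {A C D : Type w} [L.Structure A] [L.Structure C] [L.Structure D]
    (f : A ↪[L] C) (g : C ↪[L] D)
    (hfg : ∀ (n : ℕ) (φ : L.Formula (Fin n)) (a : Fin n → A),
      φ.Realize (g.comp f ∘ a) ↔ φ.Realize a) (hC : C ⊨ σ) : A ⊨ σ := by
  obtain ⟨m, φ, γ, hφ, hγ, hσ⟩ := h.exists_isUniversal_imp_isQF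
  rw [hσ] at hC ⊢
  intro x hx
  have key : ∀ {N : Type w} [L.Structure N] (z : Fin m → N),
      (φ.toFormula.relabel (Sum.elim Empty.elim id) : L.Formula (Fin m)).Realize z ↔
        φ.Realize default z := by
    intro N _ z
    rw [Formula.realize_relabel, BoundedFormula.realize_toFormula]
    exact iff_of_eq (congrArg₂ _ (Subsingleton.elim _ _) rfl)
  have hD : φ.Realize (g ∘ default) (g ∘ f ∘ x) := by
    rw [Subsingleton.elim (g ∘ default) default]
    exact (key _).1 ((hfg m _ x).2 ((key x).2 hx))
  have hγC := hC _ (hφ.realize_embedding g hD)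
  rw [← Subsingleton.elim (f ∘ default) default] at hγC
  exact (hγ.realize_embedding f).1 hγC

/-- If every structure satisfying the special Horn sentences `T` embeds into another one through a
structure satisfying the special Horn sentence `σ`, then it embeds into a structure
satisfying both `T` and `σ`. -/
lemma exists_embedding_realize_of_interleaved {T : Set L.Sentence}
    (hT : ∀ τ ∈ T, IsSpecialHorn τ) {σ : L.Sentence} (hσ : IsSpecialHorn σ)
    (H : ∀ A : LStruct.{u, v, w} L, (∀ τ ∈ T, A.carrier ⊨ τ) →
      ∃ B C : LStruct.{u, v, w} L, B.carrier ⊨ σ ∧ (∀ τ ∈ T, C.carrier ⊨ τ) ∧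
        Nonempty (A.carrier ↪[L] B.carrier) ∧ Nonempty (B.carrier ↪[L] C.carrier))
    (A : LStruct.{u, v, w} L) (hA : ∀ τ ∈ T, A.carrier ⊨ τ) :
    ∃ B : LStruct.{u, v, w} L, (∀ τ ∈ T, B.carrier ⊨ τ) ∧ B.carrier ⊨ σ ∧
      Nonempty (A.carrier ↪[L] B.carrier) := by
  choose B C hB hC p q using H
  let S : ℕ → {A : LStruct.{u, v, w} L // ∀ τ ∈ T, A.carrier ⊨ τ} :=
    fun n => Nat.rec ⟨A, hA⟩ (fun _ X => ⟨C X.1 X.2, hC X.1 X.2⟩) n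
  let G : ℕ → Type w := fun n => (S n).1.carrier
  let r : ∀ n, G n ↪[L] (B (S n).1 (S n).2).carrier := fun n => (p (S n).1 (S n).2).some
  let s : ∀ n, (B (S n).1 (S n).2).carrier ↪[L] G (n + 1) := fun n => (q (S n).1 (S n).2).some
  let step : ∀ n, G n ↪[L] G (n + 1) := fun n => (s n).comp (r n)
  let f : ∀ i j, i ≤ j → G i ↪[L] G j := DirectedSystem.natLERec step
  have hstep : ∀ i, f i (i + 1) i.le_succ = step i := fun i => by
    ext x
    simp [f, Nat.leRecOn_succ']
  let of : ∀ i, G i ↪[L] Language.DirectLimit G f := DirectLimit.of L ℕ G f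
  have hof : ∀ (m : ℕ) (x : Fin m → Language.DirectLimit G f), ∃ i, ∃ y : Fin m → G i, of i ∘ y = x := by
    intro m x
    obtain ⟨i, y, rfl⟩ := DirectLimit.exists_quotient_mk'_sigma_mk'_eq G f x
    exact ⟨i, y, rfl⟩
  refine ⟨⟨Language.DirectLimit G f⟩, fun τ hτ => ?_, ?_, ⟨of 0⟩⟩
  · refine (hT τ hτ).realize_of_forall_exists_embedding fun m x => ?_
    obtain ⟨i, y, hy⟩ := hof m x
    exact ⟨(S i).1, of i, y, (S i).2 τ hτ, hy⟩
  · refine hσ.realize_of_forall_exists_embedding fun m x => ?_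
    obtain ⟨i, y, rfl⟩ := hof m x
    refine ⟨B (S i).1 (S i).2, (of (i + 1)).comp (s i), r i ∘ y, hB _ _, funext fun a => ?_⟩
    have h := DirectLimit.of_f (L := L) (G := G) (f := f) (hij := i.le_succ) (x := y a)
    rw [hstep] at h
    exact h

end Pi2Rules

/-- if `T*` is a model companion of a set `T` of `∀∃`-Special Horn sentences,
then every model of `T` embeds into a model of `T ∪ {σ}` if and only if the `∀∃`-Special Horn
sentence `σ` holds in every model of `T*`. -/
theorem embeds_into_model_with_sigma_iff_modelCompanion_models
    {L : FirstOrder.Language.{u, v}}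
    (T : Set L.Sentence) (hT : ∀ τ ∈ T, IsSpecialHorn τ)
    (Tstar : L.Theory)
    (ha : ∀ A : LStruct.{u, v, max u v} L, (∀ τ ∈ T, A.carrier ⊨ τ) →
      ∃ B : LStruct.{u, v, max u v} L, B.carrier ⊨ Tstar ∧
        Nonempty (A.carrier ↪[L] B.carrier))
    (hb : ∀ A : LStruct.{u, v, max u v} L, A.carrier ⊨ Tstar →
      ∃ B : LStruct.{u, v, max u v} L, (∀ τ ∈ T, B.carrier ⊨ τ) ∧
        Nonempty (A.carrier ↪[L] B.carrier))
    (hc : ∀ A B : LStruct.{u, v, max u v} L, A.carrier ⊨ Tstar → B.carrier ⊨ Tstar →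
      ∀ f : A.carrier ↪[L] B.carrier, ∀ (n : ℕ) (φ : L.Formula (Fin n))
        (a : Fin n → A.carrier), φ.Realize (f ∘ a) ↔ φ.Realize a)
    (σ : L.Sentence) (hσ : IsSpecialHorn σ) :
    (∀ A : LStruct.{u, v, max u v} L, (∀ τ ∈ T, A.carrier ⊨ τ) →
        ∃ B : LStruct.{u, v, max u v} L, (∀ τ ∈ T, B.carrier ⊨ τ) ∧ B.carrier ⊨ σ ∧
          Nonempty (A.carrier ↪[L] B.carrier)) ↔
      (∀ A : LStruct.{u, v, max u v} L, A.carrier ⊨ Tstar → A.carrier ⊨ σ) := by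
  constructor
  · intro h A hA
    obtain ⟨B, hB, ⟨e⟩⟩ := hb A hA
    obtain ⟨C, hCT, hCσ, ⟨f⟩⟩ := h B hB
    obtain ⟨D, hD, ⟨g⟩⟩ := ha C hCT
    exact hσ.realize_of_elementary_comp (f.comp e) g (hc A D hA hD _) hCσ
  · intro h
    refine exists_embedding_realize_of_interleaved hT hσ fun A hA => ?_
    obtain ⟨B, hB, e⟩ := ha A hA
    obtain ⟨C, hC, f⟩ := hb B hB
    exact ⟨B, C, h B hB, hC, e, f⟩
end

section
/- Let H be a linear Heyting algebra and a, b ∈ H with a < b. Then b covers a (i.e., there is no c ∈ H with a < c < b) if and only if for every c ∈ H, ((c ⇨ a) ⇨ c) ⊓ ((b ⇨ c) ⇨ b) ≤ c ⊔ a. -/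
/-- In a linear Heyting algebra, `(x ⇨ y) ⇨ x = ⊤` unless `x ≤ y`. -/
theorem himp_himp_eq_top_of_not_le {H : Type*} [HeytingAlgebra H]
    (htot : ∀ a b : H, a ≤ b ∨ b ≤ a) {x y : H} (h : ¬ x ≤ y) : (x ⇨ y) ⇨ x = ⊤ := by
  rw [himp_eq_top_iff]
  refine (htot (x ⇨ y) x).resolve_right fun hx => h ?_
  simpa using le_himp_iff.mp hx

/-- In any Heyting algebra, `(x ⇨ y) ⇨ x = x` when `x ≤ y`. -/
theorem himp_himp_eq_self_of_le {H : Type*} [HeytingAlgebra H] {x y : H} (h : x ≤ y) :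
    (x ⇨ y) ⇨ x = x := by
  rw [himp_eq_top_iff.mpr h, top_himp]

/-- in a linear Heyting algebra, for `a < b`, `b` covers `a` if and only if
`((c ⇨ a) ⇨ c) ⊓ ((b ⇨ c) ⇨ b) ≤ c ⊔ a` holds for every `c`. -/
theorem covBy_iff_slash_inequality {H : Type*} [HeytingAlgebra H]
    (htot : ∀ a b : H, a ≤ b ∨ b ≤ a) (a b : H) (hab : a < b) :
    a ⋖ b ↔ ∀ c : H, ((c ⇨ a) ⇨ c) ⊓ ((b ⇨ c) ⇨ b) ≤ c ⊔ a := by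
  constructor
  · intro h c
    by_cases hca : c ≤ a
    · rw [himp_himp_eq_self_of_le hca]
      exact inf_le_left.trans le_sup_left
    by_cases hbc : b ≤ c
    · rw [himp_himp_eq_self_of_le hbc]
      exact inf_le_right.trans (hbc.trans le_sup_left)
    · exact absurd (lt_of_le_not_ge ((htot b c).resolve_left hbc) hbc)
        (h.2 (lt_of_le_not_ge ((htot c a).resolve_left hca) hca))
  · refine fun h => ⟨hab, fun c hac hcb => hcb.not_ge ?_⟩
    have hc := h c
    rw [himp_himp_eq_top_of_not_le htot hac.not_ge, himp_himp_eq_top_of_not_le htot hcb.not_ge,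
      inf_top_eq, sup_eq_left.mpr hac.le] at hc
    exact le_top.trans hc
end

section
/- (i) In the two-element Boolean algebra (viewed as a Heyting algebra), for every q one has (q ⇨ ⊥) ⇨ ⊥ ≤ q ⊔ ⊥, and yet ⊥ ≠ ⊤; hence the Π₂-rule ∀p(∀q(¬¬q ≤ q ⊔ p) → p = ⊤) fails there. (ii) In every three-element linear Heyting algebra H, for every p ∈ H, if (q ⇨ ⊥) ⇨ ⊥ ≤ q ⊔ p for all q ∈ H, then p = ⊤; hence the rule is valid in the three-element chain. -/
universe u

theorem exists_ne_ne_of_two_lt_natCard {α : Type*} (h : 2 < Nat.card α) (a b : α) :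
    ∃ c, c ≠ a ∧ c ≠ b := by
  by_contra! hc
  have hsub : (Set.univ : Set α) ⊆ {a, b} := fun c _ =>
    (em (c = a)).imp_right (hc c)
  have hle := Set.ncard_le_ncard hsub (Set.toFinite _)
  rw [Set.ncard_univ] at hle
  exact absurd (hle.trans (Set.ncard_insert_le a {b})) (by simpa using h)

theorem himp_bot_eq_bot_of_total {H : Type*} [HeytingAlgebra H]
    (total : ∀ a b : H, a ≤ b ∨ b ≤ a) {q : H} (hq : q ≠ ⊥) : q ⇨ ⊥ = ⊥ := by
  rw [himp_bot]
  rcases total q qᶜ with h | h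
  · exact absurd (le_compl_self.mp h) hq
  · exact disjoint_self.mp (disjoint_compl_left.mono_right h)

/-- (i) in the two-element Boolean algebra `Bool` (as a Heyting algebra),
`(q ⇨ ⊥) ⇨ ⊥ ≤ q ⊔ ⊥` for every `q`, while `⊥ ≠ ⊤`; hence the Π₂-rule
`∀p(∀q(¬¬q ≤ q ⊔ p) → p = ⊤)` fails there.  (ii) in every three-element linear Heyting
algebra the rule is valid. -/
theorem two_element_fails_and_three_element_validates :
    ((∀ q : Bool, (q ⇨ ⊥) ⇨ ⊥ ≤ q ⊔ (⊥ : Bool)) ∧ (⊥ : Bool) ≠ ⊤ ∧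
      ¬ (∀ p : Bool, (∀ q : Bool, (q ⇨ ⊥) ⇨ ⊥ ≤ q ⊔ p) → p = ⊤)) ∧
    (∀ (H : Type u) [HeytingAlgebra H], (∀ a b : H, a ≤ b ∨ b ≤ a) → Nat.card H = 3 →
      ∀ p : H, (∀ q : H, (q ⇨ ⊥) ⇨ ⊥ ≤ q ⊔ p) → p = ⊤) := by
  refine ⟨⟨by decide, by decide, by decide⟩, fun H _ total card p hp => ?_⟩
  obtain ⟨q, hq_bot, hq_top⟩ := exists_ne_ne_of_two_lt_natCard (by lia) (⊥ : H) ⊤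
  have hsup : ⊤ ≤ q ⊔ p := by
    simpa [himp_bot_eq_bot_of_total total hq_bot] using hp q
  rcases total q p with h | h
  · exact top_le_iff.mp (by rwa [sup_eq_right.mpr h] at hsup)
  · exact absurd (top_le_iff.mp (by rwa [sup_eq_left.mpr h] at hsup)) hq_top
end

section
/- Let n ≥ 1 and let H be a linear Heyting algebra with exactly n elements. Then for all p, p₁, …, pₙ ∈ H, ((p₁ ⇨ ⊥) ⇨ p₁) ⊓ ((p₂ ⇨ p₁) ⇨ p₂) ⊓ ⋯ ⊓ ((pₙ ⇨ pₙ₋₁) ⇨ pₙ) ≤ p₁ ⊔ ⋯ ⊔ pₙ ⊔ p. (Consequently, whenever H has more than one element, the Π₂-rule ρₙ := ∀p(∀p₁…pₙ(⊥/p₁ ⊓ p₁/p₂ ⊓ ⋯ ⊓ pₙ₋₁/pₙ ≤ p₁ ⊔ ⋯ ⊔ pₙ ⊔ p) → p = ⊤) fails in H.) -/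
/-- A sequence of length `n` in a total order with `n` elements and a bottom cannot increase
strictly at every step when it is started from `⊥`. -/
theorem exists_le_pred_of_card_eq {H : Type*} [PartialOrder H] [OrderBot H] [Fintype H]
    (htot : ∀ a b : H, a ≤ b ∨ b ≤ a) {n : ℕ} (hcard : Fintype.card H = n) (ps : Fin n → H) :
    ∃ i : Fin n, ps i ≤ if (i : ℕ) = 0 then ⊥
      else ps ⟨(i : ℕ) - 1, lt_of_le_of_lt (Nat.sub_le _ _) i.isLt⟩ := by
  by_contra! h
  have hmono : StrictMono (Fin.cons ⊥ ps : Fin (n + 1) → H) := by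
    refine Fin.strictMono_iff_lt_succ.2 fun i => ?_
    have hlt := lt_of_le_not_ge ((htot _ _).resolve_left (h i)) (h i)
    rw [Fin.cons_succ]
    convert hlt using 1
    split_ifs with h0
    · have : i.castSucc = 0 := Fin.ext h0
      rw [this, Fin.cons_zero]
    · have : i.castSucc =
          Fin.succ ⟨(i : ℕ) - 1, lt_of_le_of_lt (Nat.sub_le _ _) i.isLt⟩ :=
        Fin.ext (Nat.succ_pred_eq_of_ne_zero h0).symm
      rw [this, Fin.cons_succ]
  have hle := Fintype.card_le_of_injective _ hmono.injective
  rw [Fintype.card_fin, hcard] at hle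
  exact Nat.not_succ_le_self n hle

/-- in a linear Heyting algebra with exactly `n ≥ 1` elements, the inequality
`(⊥/p₁) ⊓ (p₁/p₂) ⊓ ⋯ ⊓ (pₙ₋₁/pₙ) ≤ p₁ ⊔ ⋯ ⊔ pₙ ⊔ p` holds for all `p, p₁, …, pₙ`
(where `x/y = (y ⇨ x) ⇨ y`); consequently, when `H` has more than one element, the Π₂-rule
`ρₙ` fails in `H`. -/
theorem n_chain_rho_inequality {H : Type*} [HeytingAlgebra H] [Fintype H]
    (htot : ∀ a b : H, a ≤ b ∨ b ≤ a) (n : ℕ) (hn : 1 ≤ n) (hcard : Fintype.card H = n) :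
    (∀ (p : H) (ps : Fin n → H),
      (Finset.univ.inf fun i : Fin n =>
          (ps i ⇨ (if (i : ℕ) = 0 then ⊥
            else ps ⟨(i : ℕ) - 1, lt_of_le_of_lt (Nat.sub_le _ _) i.isLt⟩)) ⇨ ps i)
        ≤ Finset.univ.sup ps ⊔ p) ∧
    (1 < n → ¬ ∀ p : H, (∀ ps : Fin n → H,
      (Finset.univ.inf fun i : Fin n =>
          (ps i ⇨ (if (i : ℕ) = 0 then ⊥
            else ps ⟨(i : ℕ) - 1, lt_of_le_of_lt (Nat.sub_le _ _) i.isLt⟩)) ⇨ ps i)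
        ≤ Finset.univ.sup ps ⊔ p) → p = ⊤) := by
  have key (p : H) (ps : Fin n → H) :
      (Finset.univ.inf fun i : Fin n =>
          (ps i ⇨ (if (i : ℕ) = 0 then ⊥
            else ps ⟨(i : ℕ) - 1, lt_of_le_of_lt (Nat.sub_le _ _) i.isLt⟩)) ⇨ ps i)
        ≤ Finset.univ.sup ps ⊔ p := by
    obtain ⟨i, hi⟩ := exists_le_pred_of_card_eq htot hcard ps
    refine (Finset.inf_le (Finset.mem_univ i)).trans ?_
    rw [himp_eq_top_iff.2 hi, top_himp]
    exact le_sup_of_le_left (Finset.le_sup (Finset.mem_univ i))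
  refine ⟨key, fun hlt hrule => ?_⟩
  have hbot : (⊥ : H) = ⊤ := hrule ⊥ (key ⊥)
  have := subsingleton_of_bot_eq_top hbot
  have hle := Fintype.card_le_one_iff_subsingleton.2 this
  omega
end
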